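/- Let ζ = exp(2πi/5), ω = (1+√5)/2, L = [0,1) + (-ζ⁻¹)[0,1), L' = ω⁻²L, and T the pentagonal piecewise rotation on L. For every x ∈ L', the first return time m(x) = min{m ≥ 1 : Tᵐ(x) ∈ L'} exists and equals 1, 3, or 6. -/

import Mathlib

noncomputable def ζ : ℂ := Complex.exp (2 * Real.pi * Complex.I / 5)
noncomputable def ω : ℂ := (1 + Real.sqrt 5) / 2

/-- The half-open lozenge L = [0,1) + (-ζ⁻¹)[0,1). -/
def L : Set ℂ :=
  {z | ∃ s t : ℝ, s ∈ Set.Ico (0:ℝ) 1 ∧ t ∈ Set.Ico (0:ℝ) 1 ∧ z = s + t * (-ζ⁻¹)}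

/-- The pentagonal piecewise rotation. -/
noncomputable def T (x : ℂ) : ℂ := if 0 ≤ (x / ζ).im then x / ζ else (x - 1) / ζ

/-- The scaled-down lozenge L' = ω⁻² L. -/
noncomputable def L' : Set ℂ := (fun z => ω⁻¹ ^ 2 * z) '' L

noncomputable def cR : ℝ := (Real.sqrt 5 - 1) / 2

noncomputable def P (s t : ℝ) : ℂ := (s : ℂ) + t * (-ζ⁻¹)

lemma cR_sq : cR * cR = 1 - cR := by
  unfold cR
  nlinarith [Real.mul_self_sqrt (show (0:ℝ) ≤ 5 by norm_num)]

lemma cR_pos : 3/5 < cR := by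
  have h : (11/5 : ℝ) < Real.sqrt 5 := by
    apply Real.lt_sqrt_of_sq_lt; norm_num
  unfold cR; linarith

lemma cR_lt : cR < 2/3 := by
  nlinarith [cR_sq, cR_pos]

lemma zeta_eq : ζ = (Real.cos (2 * Real.pi / 5) : ℂ) + Real.sin (2 * Real.pi / 5) * Complex.I := by
  unfold ζ
  rw [Complex.ofReal_cos, Complex.ofReal_sin, ← Complex.exp_mul_I]
  congr 1; push_cast; ring

lemma two_cos : 2 * Real.cos (2 * Real.pi / 5) = cR := by
  have : 2 * Real.pi / 5 = 2 * (Real.pi / 5) := by ring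
  rw [this, Real.cos_two_mul, Real.cos_pi_div_five]
  unfold cR
  nlinarith [Real.mul_self_sqrt (show (0:ℝ) ≤ 5 by norm_num)]

lemma sin_pos' : 0 < Real.sin (2 * Real.pi / 5) := by
  apply Real.sin_pos_of_pos_of_lt_pi <;> linarith [Real.pi_pos]

lemma zeta_ne : ζ ≠ 0 := Complex.exp_ne_zero _

lemma zeta_inv : ζ⁻¹ = (Real.cos (2 * Real.pi / 5) : ℂ) - Real.sin (2 * Real.pi / 5) * Complex.I := by
  apply inv_eq_of_mul_eq_one_right
  rw [zeta_eq]
  have h : ((Real.sin (2 * Real.pi / 5) : ℝ) : ℂ)^2 + (Real.cos (2 * Real.pi / 5) : ℝ)^2 = 1 := by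
    exact_mod_cast Real.sin_sq_add_cos_sq (2 * Real.pi / 5)
  linear_combination h - (Real.sin (2 * Real.pi / 5) : ℂ)^2 * Complex.I_sq

lemma zeta_inv_sq : ζ⁻¹ * ζ⁻¹ = cR * ζ⁻¹ - 1 := by
  have h : (cR : ℂ) = ζ + ζ⁻¹ := by
    rw [zeta_inv, zeta_eq, ← two_cos]; push_cast; ring
  rw [h, add_mul, mul_inv_cancel₀ zeta_ne]; ring

lemma P_im (s t : ℝ) : (P s t).im = t * Real.sin (2 * Real.pi / 5) := by
  simp only [P, zeta_inv, Complex.add_im, Complex.mul_im, Complex.neg_im, Complex.sub_im,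
    Complex.neg_re, Complex.sub_re, Complex.mul_re, Complex.ofReal_re, Complex.ofReal_im,
    Complex.I_re, Complex.I_im]
  ring

lemma P_div (s t : ℝ) : P s t / ζ = P t (cR * t - s) := by
  unfold P
  rw [div_eq_mul_inv]
  push_cast
  linear_combination (-(t:ℂ)) * zeta_inv_sq

lemma T_P0 {s t : ℝ} (h : s ≤ cR * t) : T (P s t) = P t (cR * t - s) := by
  unfold T
  rw [P_div, P_im, if_pos (mul_nonneg (by linarith) sin_pos'.le)]

lemma T_P1 {s t : ℝ} (h : cR * t < s) : T (P s t) = P t (cR * t - s + 1) := by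
  unfold T
  have : P s t - 1 = P (s - 1) t := by unfold P; push_cast; ring
  rw [P_div, P_im, if_neg (not_le.2 (mul_neg_of_neg_of_pos (by linarith) sin_pos')), this, P_div]
  congr 1; ring

lemma P_inj {s t s' t' : ℝ} (h : P s t = P s' t') : s = s' ∧ t = t' := by
  have h1 := congrArg Complex.im h
  rw [P_im, P_im] at h1
  have h2 : t = t' := mul_right_cancel₀ sin_pos'.ne' h1
  subst h2
  refine ⟨?_, rfl⟩
  unfold P at h
  exact_mod_cast add_right_cancel h

lemma omega_inv_sq : ω⁻¹ ^ 2 = ((1 - cR : ℝ) : ℂ) := by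
  have : ω⁻¹ = (cR : ℂ) := by
    apply inv_eq_of_mul_eq_one_right
    have : ω = ((1 + cR : ℝ) : ℂ) := by unfold ω cR; push_cast; ring
    rw [this, ← Complex.ofReal_mul]
    norm_cast
    linarith [cR_sq]
  rw [this, ← cR_sq]; push_cast; ring

lemma mem_L' (s t : ℝ) : P s t ∈ L' ↔ (0 ≤ s ∧ s < 1 - cR) ∧ (0 ≤ t ∧ t < 1 - cR) := by
  have hc : 0 < 1 - cR := by linarith [cR_lt]
  constructor
  · rintro ⟨z, ⟨a, b, ha, hb, rfl⟩, h⟩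
    have h' : P ((1 - cR) * a) ((1 - cR) * b) = P s t := by
      rw [← h]; simp only [omega_inv_sq]; unfold P; push_cast; ring
    obtain ⟨rfl, rfl⟩ := P_inj h'
    obtain ⟨ha0, ha1⟩ := ha
    obtain ⟨hb0, hb1⟩ := hb
    refine ⟨⟨by positivity, by nlinarith⟩, ⟨by positivity, by nlinarith⟩⟩
  · rintro ⟨⟨h1, h2⟩, h3, h4⟩
    refine ⟨P (s / (1 - cR)) (t / (1 - cR)), ⟨_, _, ⟨by positivity, (div_lt_one hc).2 h2⟩,
      ⟨by positivity, (div_lt_one hc).2 h4⟩, rfl⟩, ?_⟩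
    simp only [omega_inv_sq]
    unfold P
    have : ((1 - cR : ℝ) : ℂ) ≠ 0 := by exact_mod_cast hc.ne'
    push_cast at this ⊢
    field_simp

lemma exists_P {x : ℂ} (hx : x ∈ L') : ∃ s t : ℝ, x = P s t := by
  obtain ⟨z, ⟨a, b, -, -, rfl⟩, rfl⟩ := hx
  refine ⟨(1 - cR) * a, (1 - cR) * b, ?_⟩
  simp only [omega_inv_sq]; unfold P; push_cast; ring

/-- For every x ∈ L' the first return time to L' exists and equals 1, 3 or 6. -/
theorem first_return_time_one_three_six :
    ∀ x ∈ L', ∃ m : ℕ, (m = 1 ∨ m = 3 ∨ m = 6) ∧ T^[m] x ∈ L' ∧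
      ∀ k : ℕ, 0 < k → k < m → T^[k] x ∉ L' := by
  intro x hx
  obtain ⟨s, t, rfl⟩ := exists_P hx
  rw [mem_L'] at hx
  obtain ⟨⟨hs0, hs1⟩, ht0, ht1⟩ := hx
  have c0 := cR_pos
  have c1 := cR_lt
  have c2 := cR_sq
  have c3 : 0 < cR := by linarith
  have hcs0 : 0 ≤ cR * s := by positivity
  have hct0 : 0 ≤ cR * t := by positivity
  have hcs1 : cR * s < cR * (1 - cR) := by gcongr
  have hct1 : cR * t < cR * (1 - cR) := by gcongr
  have hcs2 : cR * s ≤ s := by nlinarith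
  have hct2 : cR * t ≤ t := by nlinarith
  have cs : cR * (cR * s) = s - cR * s := by rw [← mul_assoc, c2]; ring
  have ct : cR * (cR * t) = t - cR * t := by rw [← mul_assoc, c2]; ring
  by_cases h : s ≤ cR * t
  · refine ⟨1, by simp, ?_, fun k h1 h2 => by omega⟩
    rw [Function.iterate_one, T_P0 h, mem_L']
    refine ⟨⟨?_, ?_⟩, ?_, ?_⟩ <;> linarith
  push Not at h
  have e1 : T^[1] (P s t) = P t (cR * t - s + 1) := T_P1 h
  have e2 : T^[2] (P s t) = P (cR * t - s + 1) (cR - cR * s - cR * t) := by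
    rw [Function.iterate_succ_apply', e1, T_P0 (by linarith)]
    congr 1; linarith
  have e3 : T^[3] (P s t) = P (cR - cR * s - cR * t) (1 - cR + cR * s - t) := by
    rw [Function.iterate_succ_apply', e2, T_P1 (by linarith)]
    congr 1; linarith
  have e4 : T^[4] (P s t) = P (1 - cR + cR * s - t) (s + cR) := by
    rw [Function.iterate_succ_apply', e3, T_P1 (by linarith)]
    congr 1; linarith
  have e5 : T^[5] (P s t) = P (s + cR) t := by
    rw [Function.iterate_succ_apply', e4, T_P0 (by linarith)]
    congr 1; linarith
  have e6 : T^[6] (P s t) = P t (cR * t - s + (1 - cR)) := by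
    rw [Function.iterate_succ_apply', e5, T_P1 (by linarith)]
    congr 1; linarith
  have n1 : T^[1] (P s t) ∉ L' := by
    rw [e1, mem_L']; rintro ⟨⟨_, _⟩, _, _⟩; linarith
  have n2 : T^[2] (P s t) ∉ L' := by
    rw [e2, mem_L']; rintro ⟨⟨_, _⟩, _, _⟩; linarith
  have n4 : T^[4] (P s t) ∉ L' := by
    rw [e4, mem_L']; rintro ⟨⟨_, _⟩, _, _⟩; linarith
  have n5 : T^[5] (P s t) ∉ L' := by
    rw [e5, mem_L']; rintro ⟨⟨_, _⟩, _, _⟩; linarith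
  by_cases h3 : T^[3] (P s t) ∈ L'
  · refine ⟨3, by simp, h3, fun k h1 h2 => ?_⟩
    interval_cases k <;> assumption
  · refine ⟨6, by simp, ?_, fun k h1 h2 => ?_⟩
    · rw [e6, mem_L']
      refine ⟨⟨?_, ?_⟩, ?_, ?_⟩ <;> linarith
    · interval_cases k <;> assumption
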